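/- arXiv:2504.18292 — 2 statements merged into one kernel-verified Lean document; each statement's English description precedes it below -/
import Mathlib

section
/- Let u, v, L > 0 and let Ψ(w) = Γ(u+w)Γ(u−w)Γ(v+w)Γ(v−w)e^{Lw²}/(Γ(2w)Γ(−2w)). Then for every δ ∈ (0, min(u,v)) and every y ∈ ℝ, ∫_ℝ (dt/2π) Ψ(δ+it) [1/(δ+it−iy) + 1/(δ+it+iy)] = Ψ(iy). -/
open Complex MeasureTheory

/-- The weight function
`Ψ(w) = Γ(u+w)Γ(u−w)Γ(v+w)Γ(v−w)e^{Lw²}/(Γ(2w)Γ(−2w))`. -/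
noncomputable def Psi (u v L : ℝ) (w : ℂ) : ℂ :=
  Complex.Gamma (u + w) * Complex.Gamma (u - w) * Complex.Gamma (v + w) *
    Complex.Gamma (v - w) * Complex.exp (L * w ^ 2) /
    (Complex.Gamma (2 * w) * Complex.Gamma (-(2 * w)))

open Filter Topology

lemma two_mul_div_sq_add_sq_eq {δ : ℝ} (hδ : 0 < δ) (t : ℝ) :
    2 * δ / (δ ^ 2 + t ^ 2) = 2 / δ * (1 + (t / δ) ^ 2)⁻¹ := by
  have : δ ^ 2 + t ^ 2 ≠ 0 := by positivity
  field_simp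

lemma integrable_two_mul_div_sq_add_sq {δ : ℝ} (hδ : 0 < δ) :
    Integrable fun t : ℝ ↦ 2 * δ / (δ ^ 2 + t ^ 2) := by
  simp_rw [two_mul_div_sq_add_sq_eq hδ]
  exact (integrable_inv_one_add_sq.comp_div hδ.ne').const_mul _

lemma integral_two_mul_div_sq_add_sq {δ : ℝ} (hδ : 0 < δ) :
    ∫ t : ℝ, 2 * δ / (δ ^ 2 + t ^ 2) = 2 * Real.pi := by
  simp_rw [two_mul_div_sq_add_sq_eq hδ]
  rw [integral_const_mul, Measure.integral_comp_div (fun x : ℝ ↦ (1 + x ^ 2)⁻¹),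
    integral_univ_inv_one_add_sq, abs_of_pos hδ, smul_eq_mul]
  field_simp

lemma norm_dslope_zero_le {f : ℂ → ℂ} {B T : ℝ} {w : ℂ} (hT : 0 < T) (hw : T ≤ ‖w‖)
    (h0 : ‖f 0‖ ≤ B) (h : ‖f w‖ ≤ B) : ‖dslope f 0 w‖ ≤ 2 * B / T := by
  have hw0 : w ≠ 0 := norm_pos_iff.1 (hT.trans_le hw)
  rw [dslope_of_ne _ hw0, slope_def_field, sub_zero, norm_div]
  have := norm_sub_le (f w) (f 0)
  exact div_le_div₀ (by linarith [norm_nonneg (f 0)]) (by linarith) hT hw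

lemma tendsto_integral_dslope_horizontal {f : ℂ → ℂ} {δ B : ℝ} (hδ : 0 < δ)
    (hB : ∀ w : ℂ, |w.re| ≤ δ → ‖f w‖ ≤ B) (σ : ℝ) (hσ : |σ| = 1) :
    Tendsto (fun T : ℝ ↦ ∫ x : ℝ in (-δ)..δ, dslope f 0 (x + (σ * T : ℝ) * I)) atTop (𝓝 0) := by
  have hlim : Tendsto (fun T : ℝ ↦ 2 * B / T * |δ - -δ|) atTop (𝓝 0) := by
    simpa using (tendsto_const_nhds.div_atTop tendsto_id).mul_const (|δ - -δ|)
  refine squeeze_zero_norm' ?_ hlim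
  filter_upwards [eventually_gt_atTop 0] with T hT
  refine intervalIntegral.norm_integral_le_of_norm_le_const fun x hx ↦ ?_
  rw [Set.uIoc_of_le (by linarith)] at hx
  refine norm_dslope_zero_le hT ?_ (hB 0 (by simpa using hδ.le)) (hB _ ?_)
  · refine le_trans ?_ (abs_im_le_norm _)
    simp [abs_mul, hσ, abs_of_pos hT]
  · simpa using abs_le.2 ⟨hx.1.le, hx.2⟩

/-- Cauchy's integral formula on a vertical strip centred at the origin. -/
theorem integral_strip_sub_eq {f : ℂ → ℂ} {δ m B : ℝ} (hδ : 0 < δ) (hm : δ < m)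
    (hf : DifferentiableOn ℂ f {w | |w.re| < m})
    (hB : ∀ w : ℂ, |w.re| ≤ δ → ‖f w‖ ≤ B)
    (h₁ : Integrable fun t : ℝ ↦ f (δ + t * I) / (δ + t * I))
    (h₂ : Integrable fun t : ℝ ↦ f (-δ + t * I) / (-δ + t * I)) :
    (∫ t : ℝ, f (δ + t * I) / (δ + t * I)) - ∫ t : ℝ, f (-δ + t * I) / (-δ + t * I) =
      2 * Real.pi * f 0 := by
  have hopen : IsOpen {w : ℂ | |w.re| < m} := isOpen_lt (by fun_prop) continuous_const
  have hg : DifferentiableOn ℂ (dslope f 0) {w | |w.re| < m} :=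
    (differentiableOn_dslope (hopen.mem_nhds (by simpa using hδ.trans hm))).2 hf
  set Φ : ℝ → ℂ := fun t ↦ f (δ + t * I) / (δ + t * I) - f (-δ + t * I) / (-δ + t * I) -
    ((2 * δ / (δ ^ 2 + t ^ 2) : ℝ) : ℂ) * f 0 with hΦ
  have h₃ : Integrable fun t : ℝ ↦ ((2 * δ / (δ ^ 2 + t ^ 2) : ℝ) : ℂ) * f 0 :=
    (integrable_two_mul_div_sq_add_sq hδ).ofReal.mul_const _
  have hΦi : Integrable Φ := (h₁.sub h₂).sub h₃
  have hne : ∀ (s : ℝ), s ≠ 0 → ∀ t : ℝ, (s : ℂ) + t * I ≠ 0 := fun s hs t h ↦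
    hs (by simpa using congrArg re h)
  have hpt (t : ℝ) : dslope f 0 (δ + t * I) - dslope f 0 (((-δ : ℝ) : ℂ) + t * I) = Φ t := by
    have a := hne δ hδ.ne' t
    have b := hne (-δ) (neg_ne_zero.2 hδ.ne') t
    rw [dslope_of_ne _ a, dslope_of_ne _ b, slope_def_field, slope_def_field]
    have c : ((δ : ℂ) ^ 2 + t ^ 2) ≠ 0 := by
      norm_cast; positivity
    have c' : ((δ : ℂ) ^ 2 + t ^ 2) = -((δ + t * I) * (-δ + t * I)) := by
      linear_combination (t:ℂ) ^ 2 * I_sq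
    push_cast at b ⊢
    simp only [hΦ, sub_zero]
    push_cast
    rw [c']
    field_simp
    ring
  have hcont (s : ℝ) (hs : |s| ≤ δ) : Continuous fun t : ℝ ↦ dslope f 0 (s + t * I) :=
    hg.continuousOn.comp_continuous (by fun_prop) fun t ↦ by simpa using hs.trans_lt hm
  have hrect (T : ℝ) : ∫ t in (-T)..T, Φ t =
      I * ((∫ x : ℝ in (-δ)..δ, dslope f 0 (x + ((-1) * T : ℝ) * I)) -
        ∫ x : ℝ in (-δ)..δ, dslope f 0 (x + (1 * T : ℝ) * I)) := by
    have key := integral_boundary_rect_eq_zero_of_differentiableOn (dslope f 0)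
      (⟨-δ, -T⟩ : ℂ) ⟨δ, T⟩ (hg.mono fun w hw ↦ by
        have := hw.1
        simp only [Set.mem_preimage, Set.uIcc_of_le (show -δ ≤ δ by linarith)] at this
        exact (abs_le.2 this).trans_lt hm)
    simp only [smul_eq_mul] at key
    simp_rw [← hpt]
    rw [intervalIntegral.integral_sub
      ((hcont δ (abs_of_pos hδ).le).intervalIntegrable _ _)
      ((hcont (-δ) (by rw [abs_neg, abs_of_pos hδ])).intervalIntegrable _ _), one_mul, neg_one_mul]
    linear_combination (-I) * key + ((∫ y : ℝ in (-T)..T, dslope f 0 (δ + y * I)) -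
      ∫ y : ℝ in (-T)..T, dslope f 0 (((-δ : ℝ) : ℂ) + y * I)) * I_sq
  have hlim₁ : Tendsto (fun T : ℝ ↦ ∫ t in (-T)..T, Φ t) atTop (𝓝 (∫ t, Φ t)) :=
    intervalIntegral_tendsto_integral hΦi tendsto_neg_atTop_atBot tendsto_id
  have hlim₂ : Tendsto (fun T : ℝ ↦ ∫ t in (-T)..T, Φ t) atTop (𝓝 0) := by
    simp_rw [hrect]
    simpa only [sub_zero, mul_zero] using
      ((tendsto_integral_dslope_horizontal hδ hB (-1) (by simp)).sub
        (tendsto_integral_dslope_horizontal hδ hB 1 (by simp))).const_mul I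
  have hsplit : ∫ t, Φ t = (∫ t : ℝ, f (δ + t * I) / (δ + t * I)) -
      (∫ t : ℝ, f (-δ + t * I) / (-δ + t * I)) - ((2 * Real.pi : ℝ) : ℂ) * f 0 := by
    rw [← integral_two_mul_div_sq_add_sq hδ, ← integral_complex_ofReal, ← integral_mul_const,
      ← integral_sub h₁ h₂]
    exact integral_sub (h₁.sub h₂) h₃
  have hzero := hsplit.symm.trans (tendsto_nhds_unique hlim₁ hlim₂)
  push_cast at hzero
  linear_combination hzero

lemma norm_Gamma_le_Gamma_re {s : ℂ} (hs : 0 < s.re) : ‖Gamma s‖ ≤ Real.Gamma s.re := by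
  rw [Gamma_eq_integral hs, Real.Gamma_eq_integral hs, GammaIntegral]
  refine (norm_integral_le_integral_norm _).trans_eq ?_
  refine setIntegral_congr_fun measurableSet_Ioi fun x hx ↦ ?_
  simp only [norm_mul, norm_real, norm_cpow_eq_rpow_re_of_pos hx, sub_re, one_re,
    Real.norm_eq_abs, Real.abs_exp]

lemma exists_norm_Gamma_le {a b : ℝ} (ha : 0 < a) :
    ∃ C : ℝ, ∀ s : ℂ, a ≤ s.re → s.re ≤ b → ‖Gamma s‖ ≤ C := by
  obtain ⟨C, hC⟩ := (isCompact_Icc (a := a) (b := b)).exists_bound_of_continuousOn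
    (Real.differentiableOn_Gamma_Ioi.continuousOn.mono fun x hx ↦ ha.trans_le hx.1)
  exact ⟨C, fun s h h' ↦ (norm_Gamma_le_Gamma_re (ha.trans_le h)).trans
    ((le_abs_self _).trans (hC _ ⟨h, h'⟩))⟩

lemma inv_Gamma_mul_Gamma_neg (z : ℂ) :
    (Gamma z * Gamma (-z))⁻¹ = -(z * sin (Real.pi * z)) / Real.pi := by
  have h : (Gamma (-z))⁻¹ = -z * (Gamma (1 - z))⁻¹ := by
    rw [one_div_Gamma_eq_self_mul_one_div_Gamma_add_one, neg_add_eq_sub]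
  rw [mul_inv, h, mul_left_comm, ← mul_inv, Gamma_mul_Gamma_one_sub, inv_div]
  ring

lemma norm_sin_le_exp_norm (z : ℂ) : ‖sin z‖ ≤ Real.exp ‖z‖ := by
  rw [sin, norm_div, norm_mul, norm_I, mul_one, Complex.norm_two, div_le_iff₀ two_pos]
  have h₁ := norm_exp_le_exp_norm (-z * I)
  have h₂ := norm_exp_le_exp_norm (z * I)
  simp only [norm_mul, norm_neg, norm_I, mul_one] at h₁ h₂
  linarith [norm_sub_le (cexp (-z * I)) (cexp (z * I))]

lemma norm_inv_Gamma_mul_Gamma_neg_le (z : ℂ) :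
    ‖(Gamma z * Gamma (-z))⁻¹‖ ≤ Real.exp ((1 + Real.pi) * ‖z‖) := by
  rw [inv_Gamma_mul_Gamma_neg, norm_div, norm_neg, norm_mul, norm_real, Real.norm_eq_abs,
    abs_of_pos Real.pi_pos]
  refine (div_le_self (by positivity) (by linarith [Real.pi_gt_three])).trans ?_
  rw [add_mul, one_mul, Real.exp_add]
  gcongr
  · linarith [Real.add_one_le_exp ‖z‖]
  · refine (norm_sin_le_exp_norm _).trans_eq ?_
    rw [norm_mul, norm_real, Real.norm_eq_abs, abs_of_pos Real.pi_pos]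

lemma Psi_neg (u v L : ℝ) (w : ℂ) : Psi u v L (-w) = Psi u v L w := by
  simp only [Psi, sub_neg_eq_add, ← sub_eq_add_neg, neg_sq, mul_neg, neg_neg]
  ring

lemma Psi_eq_mul_inv (u v L : ℝ) (w : ℂ) : Psi u v L w =
    Gamma (u + w) * Gamma (u - w) * Gamma (v + w) * Gamma (v - w) * cexp (L * w ^ 2) *
      (Gamma (2 * w) * Gamma (-(2 * w)))⁻¹ := by
  rw [Psi, div_eq_mul_inv]

lemma differentiableAt_Gamma_of_re_pos {s : ℂ} (hs : 0 < s.re) : DifferentiableAt ℂ Gamma s := by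
  refine differentiableAt_Gamma s fun m h ↦ ?_
  rw [h] at hs
  simp only [neg_re, natCast_re] at hs
  linarith [m.cast_nonneg (α := ℝ)]

lemma differentiableAt_Psi (u v L : ℝ) {w : ℂ} (hw : |w.re| < min u v) :
    DifferentiableAt ℂ (Psi u v L) w := by
  obtain ⟨hwu, hwv⟩ := lt_min_iff.1 hw
  rw [abs_lt] at hwu hwv
  rw [funext (Psi_eq_mul_inv u v L)]
  have hG {g : ℂ → ℂ} (hg : DifferentiableAt ℂ g w) (h : 0 < (g w).re) :
      DifferentiableAt ℂ (fun z ↦ Gamma (g z)) w :=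
    (differentiableAt_Gamma_of_re_pos h).comp w hg
  have h₁ := hG (g := fun z ↦ u + z) (by fun_prop) (by simp; linarith)
  have h₂ := hG (g := fun z ↦ u - z) (by fun_prop) (by simp; linarith)
  have h₃ := hG (g := fun z ↦ v + z) (by fun_prop) (by simp; linarith)
  have h₄ := hG (g := fun z ↦ v - z) (by fun_prop) (by simp; linarith)
  simp_rw [inv_Gamma_mul_Gamma_neg]
  have h₅ : DifferentiableAt ℂ (fun z : ℂ ↦ -(2 * z * sin (Real.pi * (2 * z))) / Real.pi) w := by
    fun_prop
  exact ((((h₁.mul h₂).mul h₃).mul h₄).mul (by fun_prop)).mul h₅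

lemma exists_norm_Psi_le (u v : ℝ) {L δ : ℝ} (hL : 0 < L) (hδ : δ < min u v) :
    ∃ C : ℝ, ∀ w : ℂ, |w.re| ≤ δ → ‖Psi u v L w‖ ≤ C * Real.exp (-(L / 2) * w.im ^ 2) := by
  obtain ⟨hδu, hδv⟩ := lt_min_iff.1 hδ
  obtain ⟨A, hA⟩ := exists_norm_Gamma_le (a := u - δ) (b := u + δ) (sub_pos.2 hδu)
  obtain ⟨B, hB⟩ := exists_norm_Gamma_le (a := v - δ) (b := v + δ) (sub_pos.2 hδv)
  set c := 2 * (1 + Real.pi) with hc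
  refine ⟨A * A * B * B * Real.exp (L * δ ^ 2 + c * δ + c ^ 2 / (2 * L)), fun w hw ↦ ?_⟩
  have hw' := abs_le.1 hw
  have h₁ : ‖Gamma (u + w)‖ ≤ A := hA _ (by simp; linarith) (by simp; linarith)
  have h₂ : ‖Gamma (u - w)‖ ≤ A := hA _ (by simp; linarith) (by simp; linarith)
  have h₃ : ‖Gamma (v + w)‖ ≤ B := hB _ (by simp; linarith) (by simp; linarith)
  have h₄ : ‖Gamma (v - w)‖ ≤ B := hB _ (by simp; linarith) (by simp; linarith)
  have hA0 : 0 ≤ A := (norm_nonneg _).trans h₁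
  have hB0 : 0 ≤ B := (norm_nonneg _).trans h₃
  have h₅ := norm_inv_Gamma_mul_Gamma_neg_le (2 * w)
  have h₆ : ‖cexp (L * w ^ 2)‖ = Real.exp (L * (w.re ^ 2 - w.im ^ 2)) := by
    rw [norm_exp, re_ofReal_mul, sq w, mul_re, sq, sq]
  have h₇ : (1 + Real.pi) * ‖2 * w‖ ≤ c * δ + c * |w.im| := by
    rw [norm_mul, Complex.norm_two, ← mul_add, hc, mul_assoc 2, mul_left_comm]
    gcongr
    linarith [norm_le_abs_re_add_abs_im w]
  have h₈ : c * |w.im| ≤ L / 2 * w.im ^ 2 + c ^ 2 / (2 * L) := by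
    rw [← sub_nonneg, ← sq_abs w.im]
    have : L / 2 * |w.im| ^ 2 + c ^ 2 / (2 * L) - c * |w.im| =
        (L * |w.im| - c) ^ 2 / (2 * L) := by
      field_simp
      ring
    rw [this]
    positivity
  have h₉ : L * w.re ^ 2 ≤ L * δ ^ 2 := by
    gcongr L * ?_
    exact sq_le_sq' hw'.1 hw'.2
  calc ‖Psi u v L w‖
      = ‖Gamma (u + w)‖ * ‖Gamma (u - w)‖ * ‖Gamma (v + w)‖ * ‖Gamma (v - w)‖ *
          ‖cexp (L * w ^ 2)‖ * ‖(Gamma (2 * w) * Gamma (-(2 * w)))⁻¹‖ := by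
        rw [Psi_eq_mul_inv]
        simp only [norm_mul]
    _ ≤ A * A * B * B * Real.exp (L * (w.re ^ 2 - w.im ^ 2)) *
          Real.exp ((1 + Real.pi) * ‖2 * w‖) := by
        rw [h₆]
        gcongr
    _ ≤ _ := by
        rw [mul_assoc, mul_assoc (A * A * B * B), ← Real.exp_add, ← Real.exp_add]
        gcongr A * A * B * B * Real.exp ?_
        linarith

lemma integrable_Psi_div {u v L δ : ℝ} (hL : 0 < L) (hδ : 0 < δ) (hδuv : δ < min u v) (y s : ℝ)
    (hs : |s| = δ) :
    Integrable fun t : ℝ ↦ Psi u v L (s + t * I + I * y) / (s + t * I) := by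
  obtain ⟨C, hC⟩ := exists_norm_Psi_le u v hL hδuv
  have hs0 : s ≠ 0 := abs_pos.1 (hs ▸ hδ)
  have hne (t : ℝ) : (s : ℂ) + t * I ≠ 0 := fun h ↦ hs0 (by simpa using congrArg re h)
  have hcont : Continuous fun t : ℝ ↦ Psi u v L (s + t * I + I * y) / (s + t * I) := by
    refine Continuous.div (continuous_iff_continuousAt.2 fun t ↦ ?_) (by fun_prop) hne
    have hd := (differentiableAt_Psi u v L (w := s + t * I + I * y)
      (by simpa [hs] using hδuv)).continuousAt
    exact hd.comp (f := fun t : ℝ ↦ (s : ℂ) + t * I + I * y) (by fun_prop)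
  have hdom : Integrable fun t : ℝ ↦ C * Real.exp (-(L / 2) * (t + y) ^ 2) / δ :=
    (((integrable_exp_neg_mul_sq (half_pos hL)).comp_add_right y).const_mul C).div_const δ
  refine hdom.mono' hcont.aestronglyMeasurable (.of_forall fun t ↦ ?_)
  have h₁ := hC (s + t * I + I * y) (by simp [hs])
  have h₂ : δ ≤ ‖(s : ℂ) + t * I‖ := by simpa [hs] using abs_re_le_norm ((s : ℂ) + t * I)
  have him : ((s : ℂ) + t * I + I * y).im = t + y := by simp
  rw [him] at h₁
  rw [norm_div]
  exact div_le_div₀ ((norm_nonneg _).trans h₁) h₁ hδ h₂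

/-- Residue identity used to match the two formulas for the second cumulant of the
open KPZ equation: for `0 < δ < min(u,v)` and `y ∈ ℝ`,
`∫_ℝ (dt/2π) Ψ(δ+it)[1/(δ+it−iy) + 1/(δ+it+iy)] = Ψ(iy)`. -/
theorem Psi_residue_identity (u v L : ℝ) (hu : 0 < u) (hv : 0 < v) (hL : 0 < L)
    (δ : ℝ) (hδ0 : 0 < δ) (hδ : δ < min u v) (y : ℝ) :
    ∫ t : ℝ,
        Psi u v L ((δ : ℂ) + Complex.I * t) *
          (1 / ((δ : ℂ) + Complex.I * t - Complex.I * y) +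
            1 / ((δ : ℂ) + Complex.I * t + Complex.I * y)) / (2 * Real.pi)
      = Psi u v L (Complex.I * y) := by
  set F₁ : ℝ → ℂ := fun t ↦ Psi u v L (δ + t * I + I * y) / (δ + t * I) with hF₁
  set F₂ : ℝ → ℂ := fun t ↦ Psi u v L (-δ + t * I + I * y) / (-δ + t * I) with hF₂
  have h₁ : Integrable F₁ := integrable_Psi_div hL hδ0 hδ y δ (abs_of_pos hδ0)
  have h₂ : Integrable F₂ := by
    have := integrable_Psi_div hL hδ0 hδ y (-δ) (by rw [abs_neg, abs_of_pos hδ0])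
    simpa only [ofReal_neg] using this
  obtain ⟨C, hC⟩ := exists_norm_Psi_le u v hL hδ
  have hC0 : 0 ≤ C := by simpa using (norm_nonneg _).trans (hC 0 (by simpa using hδ0.le))
  have key := integral_strip_sub_eq (f := fun w ↦ Psi u v L (w + I * y)) (B := C) hδ0 hδ
    (fun w hw ↦ ((differentiableAt_Psi u v L (w := w + I * y) (by simpa using hw)).comp
      (f := fun w ↦ w + I * y) w (by fun_prop)).differentiableWithinAt)
    (fun w hw ↦ (hC _ (by simpa using hw)).trans (mul_le_of_le_one_right hC0
      (Real.exp_le_one_iff.2 (by rw [neg_mul, neg_nonpos]; positivity)))) h₁ h₂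
  have hpt (t : ℝ) : Psi u v L ((δ : ℂ) + Complex.I * t) *
      (1 / ((δ : ℂ) + Complex.I * t - Complex.I * y) +
        1 / ((δ : ℂ) + Complex.I * t + Complex.I * y)) / (2 * Real.pi) =
      (F₁ (t - y) - F₂ (-y - t)) / (2 * Real.pi) := by
    have e₁ : (δ : ℂ) + (t - y : ℝ) * I = δ + I * t - I * y := by push_cast; ring
    have e₂ : -(δ : ℂ) + (-y - t : ℝ) * I = -(δ + I * t + I * y) := by push_cast; ring
    have e₃ : -((δ : ℂ) + I * t + I * y) + I * y = -(δ + I * t) := by ring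
    simp only [hF₁, hF₂]
    rw [e₁, e₂, e₃, sub_add_cancel, Psi_neg, div_neg]
    ring
  simp_rw [hpt]
  rw [integral_div, integral_sub (h₁.comp_sub_right y) (h₂.comp_sub_left (-y)),
    integral_sub_right_eq_self F₁ y, integral_sub_left_eq_self F₂ volume (-y), key, zero_add]
  have : (Real.pi : ℂ) ≠ 0 := ofReal_ne_zero.2 Real.pi_ne_zero
  field_simp
end

section
/- For ũ, ṽ > 0 let φ(y) = 4y²e^{−y²}/((ũ²+y²)(ṽ²+y²)), and for an integer k ≥ 1 define φ_k(ũ,ṽ) = ∫_ℝ (dy/2π) φ(y)^k and ψ_k(ũ,ṽ) = ∫_ℝ (dy/2π) y² φ(y)^k. Then φ_k is differentiable in (ũ,ṽ) on (0,∞)², and ψ_k = −(1 − 1/(2k))·φ_k − (1/(2k))·(ũ·∂φ_k/∂ũ + ṽ·∂φ_k/∂ṽ). -/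
open Real MeasureTheory

/-- `φ(y) = 4y²e^{−y²}/((ũ²+y²)(ṽ²+y²))`. -/
noncomputable def phiFun (ut vt y : ℝ) : ℝ :=
  4 * y ^ 2 * Real.exp (-y ^ 2) / ((ut ^ 2 + y ^ 2) * (vt ^ 2 + y ^ 2))

/-- `φ_k(ũ,ṽ) = ∫_ℝ (dy/2π) φ(y)^k`. -/
noncomputable def phiK (k : ℕ) (ut vt : ℝ) : ℝ :=
  ∫ y : ℝ, phiFun ut vt y ^ k / (2 * Real.pi)

/-- `ψ_k(ũ,ṽ) = ∫_ℝ (dy/2π) y²φ(y)^k`. -/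
noncomputable def psiK (k : ℕ) (ut vt : ℝ) : ℝ :=
  ∫ y : ℝ, y ^ 2 * phiFun ut vt y ^ k / (2 * Real.pi)

theorem phiFun_nonneg (u v y : ℝ) : 0 ≤ phiFun u v y := by
  unfold phiFun; positivity

theorem continuous_phiFun {u v : ℝ} (hu : 0 < u) (hv : 0 < v) : Continuous (phiFun u v) := by
  unfold phiFun
  refine Continuous.div (by fun_prop) (by fun_prop) fun y => ?_
  positivity

theorem phiFun_le {u v c : ℝ} (hc : 0 < c) (hu : 0 < u) (hv : c ≤ v) (y : ℝ) :
    phiFun u v y ≤ 4 / c ^ 2 * Real.exp (-y ^ 2) := by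
  have hv' : 0 < v := hc.trans_le hv
  have hcv : c ^ 2 ≤ v ^ 2 := by gcongr
  have h : y ^ 2 * c ^ 2 ≤ (u ^ 2 + y ^ 2) * (v ^ 2 + y ^ 2) := by
    apply mul_le_mul <;> nlinarith [sq_nonneg u, sq_nonneg y]
  unfold phiFun
  rw [div_mul_eq_mul_div, div_le_div_iff₀ (by positivity) (by positivity)]
  have := mul_le_mul_of_nonneg_left h (by positivity : 0 ≤ 4 * Real.exp (-y ^ 2))
  linarith

theorem phiFun_pow_le {k : ℕ} (hk : 1 ≤ k) {u v c : ℝ} (hc : 0 < c) (hu : 0 < u) (hv : c ≤ v)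
    (y : ℝ) : phiFun u v y ^ k ≤ (4 / c ^ 2) ^ k * Real.exp (-y ^ 2) := by
  have h1 : Real.exp (-y ^ 2) ^ k ≤ Real.exp (-y ^ 2) :=
    pow_le_of_le_one (Real.exp_nonneg _) (Real.exp_le_one_iff.2 (by nlinarith [sq_nonneg y]))
      (by omega)
  calc phiFun u v y ^ k ≤ (4 / c ^ 2 * Real.exp (-y ^ 2)) ^ k :=
        pow_le_pow_left₀ (phiFun_nonneg u v y) (phiFun_le hc hu hv y) k
    _ = (4 / c ^ 2) ^ k * Real.exp (-y ^ 2) ^ k := mul_pow _ _ _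
    _ ≤ _ := by gcongr

theorem integrable_exp_neg_sq : Integrable fun y : ℝ => Real.exp (-y ^ 2) := by
  simpa using integrable_exp_neg_mul_sq (b := 1) one_pos

theorem integrable_pow_mul_phiFun_pow {k : ℕ} (hk : 1 ≤ k) (n : ℕ) {u v : ℝ} (hu : 0 < u)
    (hv : 0 < v) : Integrable fun y : ℝ => y ^ n * phiFun u v y ^ k := by
  have hg : Integrable fun y : ℝ => y ^ n * Real.exp (-y ^ 2) := by
    have := integrable_rpow_mul_exp_neg_mul_sq (b := 1) one_pos (s := n)
      (by linarith [n.cast_nonneg (α := ℝ)])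
    simpa using this
  refine (hg.const_mul ((4 / v ^ 2) ^ k)).mono
    (((continuous_id.pow n).mul ((continuous_phiFun hu hv).pow k)).aestronglyMeasurable)
    (Filter.Eventually.of_forall fun y => ?_)
  have h := phiFun_pow_le hk hv hu le_rfl y
  have h0 := pow_nonneg (phiFun_nonneg u v y) k
  rw [norm_mul, norm_mul, norm_mul, Real.norm_of_nonneg h0,
    Real.norm_of_nonneg (Real.exp_nonneg _),
    Real.norm_of_nonneg (by positivity : (0 : ℝ) ≤ (4 / v ^ 2) ^ k)]
  calc ‖y ^ n‖ * phiFun u v y ^ k ≤ ‖y ^ n‖ * ((4 / v ^ 2) ^ k * Real.exp (-y ^ 2)) := by gcongr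
    _ = _ := by ring

/-- The Fréchet derivative of `(u, v) ↦ φ(y)^k / (2π)`. -/
noncomputable def phiPowFDeriv (k : ℕ) (p : ℝ × ℝ) (y : ℝ) : ℝ × ℝ →L[ℝ] ℝ :=
  (phiFun p.1 p.2 y ^ k / (2 * Real.pi)) •
    ((-(2 * k) * (p.1 / (p.1 ^ 2 + y ^ 2))) • ContinuousLinearMap.fst ℝ ℝ ℝ +
      (-(2 * k) * (p.2 / (p.2 ^ 2 + y ^ 2))) • ContinuousLinearMap.snd ℝ ℝ ℝ)

theorem hasFDerivAt_phiFun_pow {k : ℕ} (hk : 1 ≤ k) {p : ℝ × ℝ} (hu : 0 < p.1) (hv : 0 < p.2)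
    (y : ℝ) :
    HasFDerivAt (fun p : ℝ × ℝ => phiFun p.1 p.2 y ^ k / (2 * Real.pi))
      (phiPowFDeriv k p y) p := by
  obtain ⟨n, rfl⟩ : ∃ n, k = n + 1 := ⟨k - 1, by omega⟩
  have hd : ∀ a : ℝ, 0 < a → HasDerivAt (fun a : ℝ => (a ^ 2 + y ^ 2)⁻¹)
      (-(2 * a) / (a ^ 2 + y ^ 2) ^ 2) a := fun a ha => by
    have := ((hasDerivAt_pow 2 a).add_const (y ^ 2)).fun_inv (by positivity)
    simpa using this
  have h1 := (hd p.1 hu).comp_hasFDerivAt p (hasFDerivAt_fst (𝕜 := ℝ))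
  have h2 := (hd p.2 hv).comp_hasFDerivAt p (hasFDerivAt_snd (𝕜 := ℝ))
  have h3 := (((h1.mul h2).const_mul (4 * y ^ 2 * Real.exp (-y ^ 2))).pow (n + 1)).mul_const
    (2 * Real.pi)⁻¹
  refine (h3.congr_fderiv ?_).congr_of_eventuallyEq (Filter.Eventually.of_forall fun q => ?_)
  · have e1 : p.1 ^ 2 + y ^ 2 ≠ 0 := by positivity
    have e2 : p.2 ^ 2 + y ^ 2 ≠ 0 := by positivity
    ext <;>
    · simp only [phiPowFDeriv, phiFun, pow_succ _ n]
      simp [div_eq_mul_inv]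
      rw [mul_comm (p.2 ^ 2 + y ^ 2)⁻¹ (p.1 ^ 2 + y ^ 2)⁻¹]
      generalize (_ : ℝ) ^ n = c
      field_simp
  · simp [phiFun, div_eq_mul_inv, mul_comm]

theorem norm_phiPowFDeriv_le {k : ℕ} (hk : 1 ≤ k) {p : ℝ × ℝ} {b c : ℝ} (hb : 0 < b)
    (hc : 0 < c) (hu : b ≤ p.1) (hv : c ≤ p.2) (y : ℝ) :
    ‖phiPowFDeriv k p y‖ ≤
      (4 / c ^ 2) ^ k / (2 * Real.pi) * (2 * k * (1 / b) + 2 * k * (1 / c)) *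
        Real.exp (-y ^ 2) := by
  have hfrac : ∀ a d : ℝ, 0 < d → d ≤ a → ‖-(2 * (k : ℝ)) * (a / (a ^ 2 + y ^ 2))‖
      ≤ 2 * k * (1 / d) := fun a d hd hda => by
    have ha : 0 < a := hd.trans_le hda
    rw [norm_mul, norm_neg, Real.norm_of_nonneg (by positivity), Real.norm_of_nonneg (by positivity)]
    refine mul_le_mul_of_nonneg_left ?_ (by positivity)
    rw [div_le_div_iff₀ (by positivity) hd]
    nlinarith [sq_nonneg y]
  have h0 := pow_nonneg (phiFun_nonneg p.1 p.2 y) k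
  unfold phiPowFDeriv
  rw [norm_smul, Real.norm_of_nonneg (by positivity)]
  calc _ ≤ ((4 / c ^ 2) ^ k * Real.exp (-y ^ 2)) / (2 * Real.pi) *
        (2 * k * (1 / b) + 2 * k * (1 / c)) := by
        gcongr
        · exact phiFun_pow_le hk hc (hb.trans_le hu) hv y
        · refine (norm_add_le _ _).trans (add_le_add ?_ ?_)
          · rw [norm_smul]
            exact (mul_le_of_le_one_right (norm_nonneg _)
              (ContinuousLinearMap.norm_fst_le ℝ ℝ ℝ)).trans (hfrac _ _ hb hu)
          · rw [norm_smul]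
            exact (mul_le_of_le_one_right (norm_nonneg _)
              (ContinuousLinearMap.norm_snd_le ℝ ℝ ℝ)).trans (hfrac _ _ hc hv)
    _ = _ := by ring

theorem continuous_phiPowFDeriv (k : ℕ) {p : ℝ × ℝ} (hu : 0 < p.1) (hv : 0 < p.2) :
    Continuous (phiPowFDeriv k p) := by
  have h := continuous_phiFun hu hv
  have hd : ∀ a : ℝ, 0 < a → Continuous fun y : ℝ => a / (a ^ 2 + y ^ 2) := fun a ha =>
    continuous_const.div (by fun_prop) fun y => by positivity
  have h1 := hd _ hu
  have h2 := hd _ hv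
  unfold phiPowFDeriv
  fun_prop

theorem integrable_phiPowFDeriv {k : ℕ} (hk : 1 ≤ k) {p : ℝ × ℝ} (hu : 0 < p.1)
    (hv : 0 < p.2) : Integrable (phiPowFDeriv k p) :=
  (integrable_exp_neg_sq.const_mul _).mono' (continuous_phiPowFDeriv k hu hv).aestronglyMeasurable
    (Filter.Eventually.of_forall (norm_phiPowFDeriv_le hk hu hv le_rfl le_rfl))

theorem hasFDerivAt_phiK {k : ℕ} (hk : 1 ≤ k) {u v : ℝ} (hu : 0 < u) (hv : 0 < v) :
    HasFDerivAt (fun p : ℝ × ℝ => phiK k p.1 p.2) (∫ y, phiPowFDeriv k (u, v) y) (u, v) := by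
  have hs : Set.Ioi (u / 2) ×ˢ Set.Ioi (v / 2) ∈ nhds (u, v) :=
    prod_mem_nhds (Ioi_mem_nhds (by linarith)) (Ioi_mem_nhds (by linarith))
  unfold phiK
  refine hasFDerivAt_integral_of_dominated_of_fderiv_le hs ?_ ?_
    (continuous_phiPowFDeriv k hu hv).aestronglyMeasurable
    (Filter.Eventually.of_forall fun y p hp =>
      norm_phiPowFDeriv_le hk (half_pos hu) (half_pos hv) hp.1.le hp.2.le y)
    (integrable_exp_neg_sq.const_mul _)
    (Filter.Eventually.of_forall fun y p hp =>
      hasFDerivAt_phiFun_pow hk ((half_pos hu).trans hp.1) ((half_pos hv).trans hp.2) y)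
  · filter_upwards [hs] with p hp
    exact (((continuous_phiFun ((half_pos hu).trans hp.1) ((half_pos hv).trans hp.2)).pow
      k).div_const _).aestronglyMeasurable
  · simpa using (integrable_pow_mul_phiFun_pow hk 0 hu hv).div_const (2 * Real.pi)

theorem hasDerivAt_mul_phiFun_pow {k : ℕ} (hk : 1 ≤ k) {u v : ℝ} (hu : 0 < u) (hv : 0 < v)
    (y : ℝ) :
    HasDerivAt (fun y : ℝ => y * phiFun u v y ^ k / (2 * Real.pi))
      ((1 - 2 * k) * (phiFun u v y ^ k / (2 * Real.pi))
        - 2 * k * (y ^ 2 * phiFun u v y ^ k / (2 * Real.pi))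
        - phiPowFDeriv k (u, v) y (u, v)) y := by
  obtain ⟨n, rfl⟩ : ∃ n, k = n + 1 := ⟨k - 1, by omega⟩
  have e1 : u ^ 2 + y ^ 2 ≠ 0 := by positivity
  have e2 : v ^ 2 + y ^ 2 ≠ 0 := by positivity
  have hsq := hasDerivAt_pow 2 y
  have hφ := ((hsq.const_mul 4).mul hsq.neg.exp).div
    ((hsq.const_add (u ^ 2)).mul (hsq.const_add (v ^ 2))) (mul_ne_zero e1 e2)
  have h := ((hasDerivAt_id y).mul (hφ.pow (n + 1))).div_const (2 * Real.pi)
  refine (h.congr_deriv ?_).congr_of_eventuallyEq (Filter.Eventually.of_forall fun q => ?_)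
  · simp only [phiPowFDeriv, phiFun, pow_succ _ n]
    simp
    generalize (_ : ℝ) ^ n = c
    field_simp
    ring
  · simp [phiFun]

/-- `φ_k` is differentiable on `(0,∞)²` and
`ψ_k = −(1 − 1/(2k))φ_k − (1/(2k))(ũ ∂_ũ φ_k + ṽ ∂_ṽ φ_k)`. -/
theorem psiK_eq_of_phiK (k : ℕ) (hk : 1 ≤ k) (ut vt : ℝ) (hu : 0 < ut) (hv : 0 < vt) :
    DifferentiableAt ℝ (fun p : ℝ × ℝ => phiK k p.1 p.2) (ut, vt) ∧
    psiK k ut vt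
      = -(1 - 1 / (2 * k)) * phiK k ut vt
        - (1 / (2 * k)) *
            (ut * deriv (fun a : ℝ => phiK k a vt) ut +
              vt * deriv (fun b : ℝ => phiK k ut b) vt) := by
  have hF := hasFDerivAt_phiK hk hu hv
  refine ⟨hF.differentiableAt, ?_⟩
  set L := ∫ y, phiPowFDeriv k (ut, vt) y with hL
  have hd1 : deriv (fun a : ℝ => phiK k a vt) ut = L (1, 0) :=
    (HasFDerivAt.comp_hasDerivAt (f := fun a => (a, vt)) ut hF
      ((hasDerivAt_id ut).prodMk (hasDerivAt_const ut vt))).deriv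
  have hd2 : deriv (fun b : ℝ => phiK k ut b) vt = L (0, 1) :=
    (HasFDerivAt.comp_hasDerivAt (f := fun b => (ut, b)) vt hF
      ((hasDerivAt_const vt ut).prodMk (hasDerivAt_id vt))).deriv
  have hsum : ut * L (1, 0) + vt * L (0, 1) = L (ut, vt) := by
    rw [← smul_eq_mul, ← smul_eq_mul, ← map_smul, ← map_smul, ← map_add]
    simp
  have hI := integrable_phiPowFDeriv hk (p := (ut, vt)) hu hv
  have hLI : L (ut, vt) = ∫ y, phiPowFDeriv k (ut, vt) y (ut, vt) :=
    ContinuousLinearMap.integral_apply hI _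
  have i0 : Integrable fun y : ℝ => phiFun ut vt y ^ k / (2 * Real.pi) := by
    simpa using (integrable_pow_mul_phiFun_pow hk 0 hu hv).div_const (2 * Real.pi)
  have i1 : Integrable fun y : ℝ => y * phiFun ut vt y ^ k / (2 * Real.pi) := by
    simpa using (integrable_pow_mul_phiFun_pow hk 1 hu hv).div_const (2 * Real.pi)
  have i2 := (integrable_pow_mul_phiFun_pow hk 2 hu hv).div_const (2 * Real.pi)
  have iL := hI.apply_continuousLinearMap (ut, vt)
  have j0 := i0.const_mul (1 - 2 * (k : ℝ))
  have j2 := i2.const_mul (2 * (k : ℝ))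
  have j02 : Integrable fun y : ℝ => (1 - 2 * (k : ℝ)) * (phiFun ut vt y ^ k / (2 * Real.pi))
      - 2 * k * (y ^ 2 * phiFun ut vt y ^ k / (2 * Real.pi)) := j0.sub j2
  have key := integral_eq_zero_of_hasDerivAt_of_integrable
    (hasDerivAt_mul_phiFun_pow hk hu hv) (j02.sub iL) i1
  rw [integral_sub j02 iL, integral_sub j0 j2, integral_const_mul, integral_const_mul,
    ← hLI] at key
  change (1 - 2 * (k : ℝ)) * phiK k ut vt - 2 * k * psiK k ut vt - L (ut, vt) = 0 at key
  rw [hd1, hd2, hsum]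
  have hk' : (k : ℝ) ≠ 0 := by positivity
  field_simp
  linarith
end
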